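/- arXiv:2211.07000 — 2 statements merged into one kernel-verified Lean document; each statement's English description precedes it below -/
import Mathlib

section
/- Suppose the sign of the edge {u,v} is flipped from − to +. If w ∉ N_{G⁺}(u) ∪ N_{G⁺}(v) and w ∉ {u,v}, then for every x ∈ N_{G⁺}(w), the vertices x and w are in ε-agreement in G⁺ if and only if they are in ε-agreement in H⁺. -/
open SimpleGraph

/-- `NonAgreement G x y = |N_G(x) Δ N_G(y)| / max(|N_G(x)|, |N_G(y)|)` as a rational number. -/
noncomputable def NonAgreement {V : Type*} [Fintype V] (G : SimpleGraph V) (x y : V) : ℚ :=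
  ((symmDiff (G.neighborSet x) (G.neighborSet y)).ncard : ℚ) /
    ((max (G.neighborSet x).ncard (G.neighborSet y).ncard : ℕ) : ℚ)

/-- Vertices `x` and `y` are in `ε`-agreement in `G` if they are adjacent
and `NonAgreement G x y < ε`. -/
def EpsAgree {V : Type*} [Fintype V] (ε : ℚ) (G : SimpleGraph V) (x y : V) : Prop :=
  G.Adj x y ∧ NonAgreement G x y < ε

theorem neighborSet_sup_edge_of_ne {V : Type*} (G : SimpleGraph V) {u v a : V}
    (hu : a ≠ u) (hv : a ≠ v) :
    (G ⊔ fromEdgeSet {s(u, v)}).neighborSet a = G.neighborSet a := by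
  ext b
  simp [hu, hv]

theorem stmt10 {V : Type*} [Fintype V] (G H : SimpleGraph V) (u v w : V) (ε : ℚ) (hε : 0 < ε)
    (huv : u ≠ v) (hnadj : ¬ G.Adj u v)
    (hH : H = G ⊔ fromEdgeSet {s(u, v)})
    (hw : w ∉ G.neighborSet u ∪ G.neighborSet v) (hwuv : w ∉ ({u, v} : Set V)) :
    ∀ x ∈ G.neighborSet w, (EpsAgree ε G x w ↔ EpsAgree ε H x w) := by
  intro x hx
  subst hH
  simp only [Set.mem_union, mem_neighborSet, not_or, Set.mem_insert_iff,
    Set.mem_singleton_iff] at hx hw hwuv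
  have hxu : x ≠ u := by rintro rfl; exact hw.1 hx.symm
  have hxv : x ≠ v := by rintro rfl; exact hw.2 hx.symm
  have hNx := neighborSet_sup_edge_of_ne G hxu hxv
  have hNw := neighborSet_sup_edge_of_ne G hwuv.1 hwuv.2
  simp only [EpsAgree, NonAgreement, ← mem_neighborSet, hNx, hNw]
end

section
/- Suppose the sign of the edge {u,v} is flipped from + to −. If w ∈ N_{G⁺}(u) \ N_{G⁺}(v), |N_{G⁺}(u)| ≤ |N_{G⁺}(w)|, and w ≠ v, then NonAgreement_{H⁺}(u,w) < NonAgreement_{G⁺}(u,w). -/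
open SimpleGraph

theorem SimpleGraph.neighborSet_deleteEdges_pair_left {V : Type*} (G : SimpleGraph V) (u v : V) :
    (G.deleteEdges {s(u, v)}).neighborSet u = G.neighborSet u \ {v} := by
  ext x
  simp only [mem_neighborSet, deleteEdges_adj, Set.mem_singleton_iff, Set.mem_sdiff,
    Sym2.congr_right]

theorem SimpleGraph.neighborSet_deleteEdges_pair_of_ne {V : Type*} (G : SimpleGraph V)
    {u v w : V} (hu : w ≠ u) (hv : w ≠ v) :
    (G.deleteEdges {s(u, v)}).neighborSet w = G.neighborSet w := by
  ext x
  simp [hu, hv]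

theorem stmt14 {V : Type*} [Fintype V] (G H : SimpleGraph V) (u v w : V)
    (huv : u ≠ v) (hadj : G.Adj u v)
    (hH : H = G.deleteEdges {s(u, v)})
    (hwu : w ∈ G.neighborSet u) (hwv : w ∉ G.neighborSet v)
    (hdeg : (G.neighborSet u).ncard ≤ (G.neighborSet w).ncard) (hwne : w ≠ v) :
    NonAgreement H u w < NonAgreement G u w := by
  have hvw : v ∉ G.neighborSet w := fun h => hwv (G.adj_symm h)
  have hmem : v ∈ symmDiff (G.neighborSet u) (G.neighborSet w) := Or.inl ⟨hadj, hvw⟩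
  have hsd : symmDiff (G.neighborSet u \ {v}) (G.neighborSet w) =
      symmDiff (G.neighborSet u) (G.neighborSet w) \ {v} := by
    ext x
    by_cases hx : x = v
    · subst hx
      simpa [Set.mem_symmDiff] using hvw
    · simp [Set.mem_symmDiff, hx]
  have hpos : 0 < (G.neighborSet w).ncard := (Set.ncard_pos).2 ⟨u, G.adj_symm hwu⟩
  have hle : (G.neighborSet u \ {v}).ncard ≤ (G.neighborSet w).ncard :=
    (Set.ncard_sdiff_singleton_le _ _).trans hdeg
  have hlt := Set.ncard_sdiff_singleton_lt_of_mem hmem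
  rw [NonAgreement, NonAgreement, hH, neighborSet_deleteEdges_pair_left,
    neighborSet_deleteEdges_pair_of_ne G (G.ne_of_adj hwu).symm hwne, hsd,
    max_eq_right hdeg, max_eq_right hle]
  gcongr
end
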